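/- Let X be an n×n real Gaussian matrix, let ε ∈ (0,1), and let Y = √(1−ε)·X + √ε·U be an ε-noise of X, where U is an n×n real Gaussian matrix independent of X. Then E[ perm(X)² · perm(Y)² ] = (n!)² · Σ_{m=0}^{n} (m+1)·(1−ε)^m. -/

import Mathlib

open MeasureTheory ProbabilityTheory Filter

/-- The distribution of an n×n real Gaussian matrix: i.i.d. standard real Gaussian
entries (mean 0, variance 1). -/
noncomputable def gMatR (n : ℕ) : Measure (Fin n → Fin n → ℝ) :=
  Measure.pi fun _ => Measure.pi fun _ => gaussianReal 0 1

/-- The permanent of an n×n real matrix. -/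
noncomputable def rperm {n : ℕ} (A : Fin n → Fin n → ℝ) : ℝ :=
  ∑ σ : Equiv.Perm (Fin n), ∏ i, A i (σ i)

/-- The ε-noise of a matrix X with noise matrix U: √(1-ε)·X + √ε·U. -/
noncomputable def noisyR {n : ℕ} (ε : ℝ) (X U : Fin n → Fin n → ℝ) : Fin n → Fin n → ℝ :=
  fun i j => Real.sqrt (1 - ε) * X i j + Real.sqrt ε * U i j

/-- g(X) = E[perm(Y)² | X], where Y is an ε-noise of X: since the noise matrix U is
independent of X, this conditional expectation is the integral over U. -/
noncomputable def gFunR (n : ℕ) (ε : ℝ) (X : Fin n → Fin n → ℝ) : ℝ :=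
  ∫ U, (rperm (noisyR ε X U)) ^ 2 ∂(gMatR n)

/-- Covariance of two real random variables: Cov(f,g) = E[(f - E f)(g - E g)]. -/
noncomputable def cov {α : Type*} [MeasurableSpace α] (μ : Measure α) (f g : α → ℝ) : ℝ :=
  ∫ x, (f x - ∫ y, f y ∂μ) * (g x - ∫ y, g y ∂μ) ∂μ

/-- Correlation: corr(f,g) = Cov(f,g)/(√Var(f)·√Var(g)). -/
noncomputable def corr {α : Type*} [MeasurableSpace α] (μ : Measure α) (f g : α → ℝ) : ℝ :=
  cov μ f g / (Real.sqrt (cov μ f f) * Real.sqrt (cov μ g g))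

/-- The triples of permutations which, over each value of `f`, fix one permutation and
identify the other two. -/
def IsLinked {α : Type*} (f : α → Fin 3) (p : Equiv.Perm α × Equiv.Perm α × Equiv.Perm α) : Prop :=
  ∀ i, (f i = 0 → i = p.1 i ∧ p.2.1 i = p.2.2 i) ∧
    (f i = 1 → i = p.2.1 i ∧ p.1 i = p.2.2 i) ∧ (f i = 2 → i = p.2.2 i ∧ p.1 i = p.2.1 i)

theorem Equiv.Perm.exists_mask {α : Type*} {β : Type*} [DecidableEq β] (f : α → β)
    (π : Equiv.Perm α) (h : f ∘ π = f) (k : β) :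
    ∃ σ : Equiv.Perm α, ∀ i, σ i = if f i = k then i else π i := by
  have h' : ∀ i, f (π i) = f i := fun i => congrFun h i
  have hs : ∀ i, f (π.symm i) = f i := fun i => by
    rw [← h' (π.symm i), Equiv.apply_symm_apply]
  refine ⟨⟨fun i => if f i = k then i else π i, fun i => if f i = k then i else π.symm i,
    fun i => ?_, fun i => ?_⟩, fun i => rfl⟩
  · by_cases hi : f i = k <;> simp [hi, h']
  · by_cases hi : f i = k <;> simp [hi, hs]

theorem IsLinked.apply_eq {α : Type*} [Finite α] {f : α → Fin 3}
    {p : Equiv.Perm α × Equiv.Perm α × Equiv.Perm α} (h : IsLinked f p) :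
    ∃ π : Equiv.Perm α, f ∘ π = f ∧ ∀ i, p.1 i = (if f i = 0 then i else π i) ∧
      p.2.1 i = (if f i = 1 then i else π i) ∧ p.2.2 i = (if f i = 2 then i else π i) := by
  obtain ⟨σ, τ, υ⟩ := p
  have h0 : ∀ i, f i = 0 → σ i = i ∧ τ i = υ i := fun i hi =>
    ⟨((h i).1 hi).1.symm, ((h i).1 hi).2⟩
  have h1 : ∀ i, f i = 1 → τ i = i ∧ σ i = υ i := fun i hi =>
    ⟨((h i).2.1 hi).1.symm, ((h i).2.1 hi).2⟩
  have h2 : ∀ i, f i = 2 → υ i = i ∧ σ i = τ i := fun i hi =>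
    ⟨((h i).2.2 hi).1.symm, ((h i).2.2 hi).2⟩
  have fix : ∀ (ρ : Equiv.Perm α) (k : Fin 3), (∀ i, f i = k → ρ i = i) →
      ∀ i, f i ≠ k → f (ρ i) ≠ k := fun ρ k hρ i hi hk =>
    hi (by rw [ρ.injective (hρ _ hk)] at hk; exact hk)
  have fσ := fix σ 0 fun i hi => (h0 i hi).1
  have fτ := fix τ 1 fun i hi => (h1 i hi).1
  have fυ := fix υ 2 fun i hi => (h2 i hi).1
  have cases3 : ∀ i, f i = 0 ∨ f i = 1 ∨ f i = 2 := fun i => by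
    generalize f i = k; revert k; decide
  have hf : ∀ i, f (if f i = 0 then τ i else σ i) = f i := by
    intro i
    rcases cases3 i with hi | hi | hi
    · have a := fτ i (by simp [hi])
      have b := fυ i (by simp [hi])
      rw [← (h0 i hi).2] at b
      have := cases3 (τ i)
      simp only [hi, if_true]; tauto
    · have a := fσ i (by simp [hi])
      have b := fυ i (by simp [hi])
      rw [← (h1 i hi).2] at b
      have := cases3 (σ i)
      simp only [hi, one_ne_zero, if_false]; tauto
    · have a := fσ i (by simp [hi])
      have b := fτ i (by simp [hi])
      rw [← (h2 i hi).2] at b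
      have := cases3 (σ i)
      simp only [hi, show (2 : Fin 3) ≠ 0 by decide, if_false]; tauto
  have inj : Function.Injective fun i => if f i = 0 then τ i else σ i := by
    intro i j hij
    have e : f i = f j := by rw [← hf i, ← hf j]; exact congrArg f hij
    by_cases hi : f i = 0
    · simpa [hi, ← e] using hij
    · simpa [hi, ← e] using hij
  refine ⟨Equiv.ofBijective _ (Finite.injective_iff_bijective.1 inj), funext hf, fun i => ?_⟩
  rcases cases3 i with hi | hi | hi
  · simp [hi, h0 i hi]
  · simp [hi, h1 i hi]
  · simp [hi, h2 i hi]

theorem card_isLinked {α : Type*} [Fintype α] [DecidableEq α] (f : α → Fin 3) :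
    Nat.card {p // IsLinked f p} = ∏ k, (Fintype.card {a // f a = k}).factorial := by
  rw [← DomMulAct.stabilizer_card, ← Nat.card_eq_fintype_card]
  symm
  choose m hm using fun (π : {g : Equiv.Perm α // f ∘ g = f}) =>
    Equiv.Perm.exists_mask f π.1 π.2
  refine Nat.card_congr (Equiv.ofBijective
    (fun π => ⟨(m π 0, m π 1, m π 2), fun i => ?_⟩) ⟨fun π π' h => ?_, fun p => ?_⟩)
  · simp only [hm]
    refine ⟨fun hi => ?_, fun hi => ?_, fun hi => ?_⟩ <;> simp [hi]
  · have h' := congrArg Subtype.val h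
    ext i
    have a := congrArg (fun p : Equiv.Perm α × Equiv.Perm α × Equiv.Perm α => p.1 i) h'
    have b := congrArg (fun p : Equiv.Perm α × Equiv.Perm α × Equiv.Perm α => p.2.1 i) h'
    simp only [hm] at a b
    by_cases hi : f i = 0
    · simpa [hi] using b
    · simpa [hi] using a
  · obtain ⟨π, hπ, e⟩ := p.2.apply_eq
    refine ⟨⟨π, hπ⟩, Subtype.ext (Prod.ext ?_ (Prod.ext ?_ ?_))⟩ <;> ext i
    · exact (hm ⟨π, hπ⟩ 0 i).trans (e i).1.symm
    · exact (hm ⟨π, hπ⟩ 1 i).trans (e i).2.1.symm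
    · exact (hm ⟨π, hπ⟩ 2 i).trans (e i).2.2.symm

/-- The real-valued Kronecker delta. -/
def kron {α : Type*} [DecidableEq α] (a b : α) : ℝ := if a = b then 1 else 0

theorem sum_prod_kron_powerset {α : Type*} [Fintype α] [DecidableEq α] {S T : Finset α}
    (hT : T ⊆ S) :
    ∑ p : Equiv.Perm α × Equiv.Perm α × Equiv.Perm α,
      ((∏ i ∈ T, kron i (p.2.1 i) * kron (p.1 i) (p.2.2 i)) *
        (∏ i ∈ S \ T, kron i (p.2.2 i) * kron (p.1 i) (p.2.1 i))) *
        ∏ i ∈ Finset.univ \ S, kron i (p.1 i) * kron (p.2.1 i) (p.2.2 i) =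
      ((Fintype.card α - S.card).factorial * (T.card.factorial * (S.card - T.card).factorial) :
        ℕ) := by
  classical
  set f : α → Fin 3 := fun i => if i ∈ T then 1 else if i ∈ S then 2 else 0 with hf
  have f0 : ∀ i, f i = 0 ↔ i ∈ Finset.univ \ S := fun i => by
    by_cases h : i ∈ T
    · simp [hf, h, hT h]
    · by_cases h' : i ∈ S <;> simp [hf, h, h']
  have f1 : ∀ i, f i = 1 ↔ i ∈ T := fun i => by
    by_cases h : i ∈ T
    · simp [hf, h]
    · by_cases h' : i ∈ S <;> simp [hf, h, h']
  have f2 : ∀ i, f i = 2 ↔ i ∈ S \ T := fun i => by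
    by_cases h : i ∈ T
    · simp [hf, h]
    · by_cases h' : i ∈ S <;> simp [hf, h, h']
  have hc := card_isLinked f
  rw [Fin.prod_univ_three, Nat.card_eq_fintype_card, Fintype.card_subtype] at hc
  simp only [f0, f1, f2, Fintype.card_coe, Finset.card_sdiff_of_subset hT,
    Finset.card_univ_sdiff] at hc
  rw [mul_assoc] at hc
  rw [← hc, Finset.card_filter, Nat.cast_sum]
  refine Finset.sum_congr rfl fun p _ => ?_
  have e : ∀ (R : Finset α) (a b c d : α → α),
      ∏ i ∈ R, kron (a i) (b i) * kron (c i) (d i) =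
        if ∀ i ∈ R, a i = b i ∧ c i = d i then 1 else 0 := by
    intro R a b c d
    simp only [kron, ← ite_and, mul_ite, mul_one, mul_zero, Finset.prod_ite_zero,
      Finset.prod_const_one]
    simp only [and_comm]
  have hL : IsLinked f p ↔ ((∀ i ∈ T, i = p.2.1 i ∧ p.1 i = p.2.2 i) ∧
      (∀ i ∈ S \ T, i = p.2.2 i ∧ p.1 i = p.2.1 i)) ∧
      ∀ i ∈ Finset.univ \ S, i = p.1 i ∧ p.2.1 i = p.2.2 i := by
    simp only [IsLinked, f0, f1, f2, forall_and]
    tauto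
  rw [e, e, e]
  simp only [hL, ite_and]
  split_ifs <;> simp

theorem sum_prod_kron_triple (α : Type*) [Fintype α] [DecidableEq α] (r : ℝ) :
    ∑ p : Equiv.Perm α × Equiv.Perm α × Equiv.Perm α,
      ∏ i, (r * (kron i (p.2.1 i) * kron (p.1 i) (p.2.2 i) +
        kron i (p.2.2 i) * kron (p.1 i) (p.2.1 i)) + kron i (p.1 i) * kron (p.2.1 i) (p.2.2 i)) =
      (Fintype.card α).factorial *
        ∑ m ∈ Finset.range (Fintype.card α + 1), ((m : ℝ) + 1) * r ^ m := by
  simp only [Finset.prod_add, Finset.prod_mul_distrib (f := fun _ => r), Finset.prod_const,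
    Finset.sum_mul, Finset.mul_sum]
  rw [Finset.sum_comm]
  have step : ∀ S : Finset α,
      ∑ p : Equiv.Perm α × Equiv.Perm α × Equiv.Perm α, ∑ T ∈ S.powerset,
        r ^ S.card * ((∏ i ∈ T, kron i (p.2.1 i) * kron (p.1 i) (p.2.2 i)) *
        (∏ i ∈ S \ T, kron i (p.2.2 i) * kron (p.1 i) (p.2.1 i))) *
        ∏ i ∈ Finset.univ \ S, kron i (p.1 i) * kron (p.2.1 i) (p.2.2 i) =
      (fun m : ℕ => r ^ m * ((Fintype.card α - m).factorial * (m + 1).factorial)) S.card := by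
    intro S
    rw [Finset.sum_comm]
    simp only [mul_assoc (r ^ S.card), ← Finset.mul_sum]
    rw [Finset.sum_congr rfl fun T hT => sum_prod_kron_powerset (Finset.mem_powerset.1 hT),
      ← Nat.cast_sum, ← Finset.mul_sum,
      Finset.sum_powerset_apply_card (fun m => m.factorial * (S.card - m).factorial)]
    have : ∀ m ∈ Finset.range (S.card + 1),
        S.card.choose m • (m.factorial * (S.card - m).factorial) = S.card.factorial := by
      intro m hm
      rw [smul_eq_mul, ← mul_assoc, Nat.choose_mul_factorial_mul_factorial
        (Nat.lt_succ_iff.1 (Finset.mem_range.1 hm))]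
    rw [Finset.sum_congr rfl this]
    simp [Nat.factorial_succ]
  rw [Finset.sum_congr rfl fun S _ => step S,
    Finset.sum_powerset_apply_card
      (fun m : ℕ => r ^ m * (((Fintype.card α - m).factorial : ℝ) * (m + 1).factorial)),
    Finset.card_univ]
  refine Finset.sum_congr rfl fun m hm => ?_
  rw [← Nat.choose_mul_factorial_mul_factorial (Nat.lt_succ_iff.1 (Finset.mem_range.1 hm)),
    Nat.factorial_succ]
  simp only [nsmul_eq_mul]
  push_cast
  ring

theorem sum_prod_kron_perm (α : Type*) [Fintype α] [DecidableEq α] (r : ℝ) :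
    ∑ σ₁ : Equiv.Perm α, ∑ σ₂ : Equiv.Perm α, ∑ τ₁ : Equiv.Perm α, ∑ τ₂ : Equiv.Perm α,
      ∏ i, (r * (kron (σ₁ i) (τ₁ i) * kron (σ₂ i) (τ₂ i) +
        kron (σ₁ i) (τ₂ i) * kron (σ₂ i) (τ₁ i)) + kron (σ₁ i) (σ₂ i) * kron (τ₁ i) (τ₂ i)) =
      ((Fintype.card α).factorial : ℝ) ^ 2 *
        ∑ m ∈ Finset.range (Fintype.card α + 1), ((m : ℝ) + 1) * r ^ m := by
  have key := sum_prod_kron_triple α r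
  simp only [Fintype.sum_prod_type] at key
  rw [sq, mul_assoc, ← key, ← Fintype.card_perm, ← nsmul_eq_mul, ← Finset.card_univ,
    ← Finset.sum_const]
  refine Finset.sum_congr rfl fun ρ _ => ?_
  have kron_apply : ∀ a b : α, kron (ρ a) (ρ b) = kron a b := fun a b => by
    simp [kron]
  rw [← Equiv.sum_comp (Equiv.mulLeft ρ)]
  refine Finset.sum_congr rfl fun σ _ => ?_
  rw [← Equiv.sum_comp (Equiv.mulLeft ρ)]
  refine Finset.sum_congr rfl fun τ _ => ?_
  rw [← Equiv.sum_comp (Equiv.mulLeft ρ)]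
  simp [kron_apply]

theorem integrable_pow_gaussianReal (m : ℕ) :
    Integrable (fun x : ℝ => x ^ m) (gaussianReal 0 1) :=
  integrable_pow_of_mem_interior_integrableExpSet (X := id) (by simp) m

theorem integral_pow_gaussianReal (m : ℕ) :
    ∫ x, x ^ m ∂gaussianReal 0 1 = iteratedDeriv m (fun t : ℝ => Real.exp (t ^ 2 / 2)) 0 := by
  have h := iteratedDeriv_mgf_zero (X := id) (μ := gaussianReal 0 1) (by simp) m
  rw [mgf_id_gaussianReal] at h
  simpa using h.symm

theorem integral_sq_gaussianReal_and_integral_pow_four_gaussianReal :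
    ∫ x, x ^ 2 ∂gaussianReal 0 1 = 1 ∧ ∫ x, x ^ 4 ∂gaussianReal 0 1 = 3 := by
  have he : ∀ t : ℝ, HasDerivAt (fun t : ℝ => Real.exp (t ^ 2 / 2))
      (t * Real.exp (t ^ 2 / 2)) t := fun t => by
    convert! ((hasDerivAt_pow 2 t).div_const 2).exp using 1
    simp; ring
  have d1 : deriv (fun t : ℝ => Real.exp (t ^ 2 / 2)) = fun t => t * Real.exp (t ^ 2 / 2) :=
    funext fun t => (he t).deriv
  have d2 : deriv (fun t : ℝ => t * Real.exp (t ^ 2 / 2)) =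
      fun t => (1 + t ^ 2) * Real.exp (t ^ 2 / 2) :=
    funext fun t => ((hasDerivAt_id' t).mul (he t)).deriv.trans (by ring)
  have d3 : deriv (fun t : ℝ => (1 + t ^ 2) * Real.exp (t ^ 2 / 2)) =
      fun t => (3 * t + t ^ 3) * Real.exp (t ^ 2 / 2) :=
    funext fun t => (((hasDerivAt_pow 2 t).const_add 1).mul (he t)).deriv.trans
      (by simp; ring)
  have d4 : deriv (fun t : ℝ => (3 * t + t ^ 3) * Real.exp (t ^ 2 / 2)) =
      fun t => (3 + 6 * t ^ 2 + t ^ 4) * Real.exp (t ^ 2 / 2) :=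
    funext fun t => ((((hasDerivAt_id' t).const_mul 3).add (hasDerivAt_pow 3 t)).mul
      (he t)).deriv.trans (by simp; ring)
  constructor
  · rw [integral_pow_gaussianReal]
    simp [iteratedDeriv_succ, d1, d2]
  · rw [integral_pow_gaussianReal]
    simp [iteratedDeriv_succ, d1, d2, d3, d4]

theorem mul_noisy_eq {α : Type*} (s t : ℝ) (a b c d : α) (q : (α → ℝ) × (α → ℝ)) :
    q.1 a * q.1 b * ((s * q.1 c + t * q.2 c) * (s * q.1 d + t * q.2 d)) =
      s ^ 2 * (q.1 a * q.1 b * q.1 c * q.1 d) + s * t * (q.1 a * q.1 b * q.1 c * q.2 d) +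
      s * t * (q.1 a * q.1 b * q.1 d * q.2 c) +
      t ^ 2 * (q.1 a * q.1 b * (q.2 c * q.2 d)) := by
  ring

section GaussianVector

variable {α : Type*} [Fintype α]

/-- The standard Gaussian measure on `α → ℝ`. -/
noncomputable def gVecR (α : Type*) [Fintype α] : Measure (α → ℝ) :=
  Measure.pi fun _ => gaussianReal 0 1

instance : IsProbabilityMeasure (gVecR α) := by unfold gVecR; infer_instance

theorem integrable_prod_pow_gVecR (m : α → ℕ) :
    Integrable (fun x => ∏ k, x k ^ m k) (gVecR α) :=
  Integrable.fintype_prod fun k => integrable_pow_gaussianReal (m k)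

theorem integral_prod_pow_gVecR (m : α → ℕ) :
    ∫ x, ∏ k, x k ^ m k ∂gVecR α = ∏ k, ∫ y, y ^ m k ∂gaussianReal 0 1 :=
  integral_fintype_prod_eq_prod (fun k (y : ℝ) => y ^ m k)

theorem integral_prod_pow_gVecR_eq_zero {m : α → ℕ} {a : α} (h : m a = 1) :
    ∫ x, ∏ k, x k ^ m k ∂gVecR α = 0 := by
  rw [integral_prod_pow_gVecR]
  refine Finset.prod_eq_zero (Finset.mem_univ a) ?_
  simp [h]

variable [DecidableEq α]

theorem prod_pow_single (x : α → ℝ) (a : α) (m : ℕ) :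
    ∏ k, x k ^ (Pi.single a m : α → ℕ) k = x a ^ m := by
  rw [Finset.prod_eq_single a (fun b _ hb => by simp [hb]) (by simp)]
  simp

theorem integrable_mul_four_gVecR (a b c d : α) :
    Integrable (fun x => x a * x b * x c * x d) (gVecR α) := by
  have h_moment := integrable_prod_pow_gVecR
    (Pi.single a 1 + Pi.single b 1 + Pi.single c 1 + Pi.single d 1 : α → ℕ)
  simpa only [Pi.add_apply, pow_add, Finset.prod_mul_distrib, prod_pow_single,
    pow_one] using h_moment

theorem integrable_mul_three_gVecR (a b c : α) :
    Integrable (fun x => x a * x b * x c) (gVecR α) := by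
  have h_moment := integrable_prod_pow_gVecR
    (Pi.single a 1 + Pi.single b 1 + Pi.single c 1 : α → ℕ)
  simpa only [Pi.add_apply, pow_add, Finset.prod_mul_distrib, prod_pow_single,
    pow_one] using h_moment

theorem integrable_mul_two_gVecR (a b : α) :
    Integrable (fun x => x a * x b) (gVecR α) := by
  have h_moment := integrable_prod_pow_gVecR (Pi.single a 1 + Pi.single b 1 : α → ℕ)
  simpa only [Pi.add_apply, pow_add, Finset.prod_mul_distrib, prod_pow_single,
    pow_one] using h_moment

theorem integrable_apply_gVecR (a : α) : Integrable (fun x => x a) (gVecR α) := by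
  simpa only [prod_pow_single, pow_one] using integrable_prod_pow_gVecR (Pi.single a 1)

theorem integral_apply_gVecR (a : α) : ∫ x, x a ∂gVecR α = 0 := by
  simpa only [prod_pow_single, pow_one] using
    integral_prod_pow_gVecR_eq_zero (m := Pi.single a 1) (a := a) (by simp)

theorem integral_pow_apply_gVecR (a : α) (m : ℕ) :
    ∫ x, x a ^ m ∂gVecR α = ∫ y, y ^ m ∂gaussianReal 0 1 := by
  have h := integral_prod_pow_gVecR (Pi.single a m)
  rw [Finset.prod_eq_single a (fun b _ hb => by simp [hb]) (by simp)] at h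
  simpa only [prod_pow_single, Pi.single_eq_same] using h

theorem integral_mul_two_gVecR (a b : α) : ∫ x, x a * x b ∂gVecR α = kron a b := by
  by_cases h : a = b
  · subst h
    simpa [kron, ← sq, integral_sq_gaussianReal_and_integral_pow_four_gaussianReal.1] using
      integral_pow_apply_gVecR a 2
  · have h_moment := integral_prod_pow_gVecR_eq_zero
      (m := (Pi.single a 1 + Pi.single b 1 : α → ℕ)) (a := a) (by simp [h])
    simpa only [Pi.add_apply, pow_add, Finset.prod_mul_distrib, prod_pow_single,
    pow_one, kron, h, if_false] using h_moment

theorem integral_sq_mul_sq_gVecR {a b : α} (h : a ≠ b) :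
    ∫ x, x a ^ 2 * x b ^ 2 ∂gVecR α = 1 := by
  have := integral_prod_pow_gVecR (Pi.single a 2 + Pi.single b 2 : α → ℕ)
  rw [Finset.prod_eq_one] at this
  · simpa only [Pi.add_apply, pow_add, Finset.prod_mul_distrib, prod_pow_single] using this
  · intro k _
    have h2 := integral_sq_gaussianReal_and_integral_pow_four_gaussianReal.1
    by_cases ha : k = a
    · subst ha; simp [h, h2]
    · by_cases hb : k = b
      · subst hb; simp [ha, h2]
      · simp [ha, hb]

theorem integral_mul_four_gVecR_eq_zero {a b c d : α} (hb : a ≠ b) (hc : a ≠ c) (hd : a ≠ d) :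
    ∫ x, x a * x b * x c * x d ∂gVecR α = 0 := by
  have h_moment := integral_prod_pow_gVecR_eq_zero
    (m := (Pi.single a 1 + Pi.single b 1 + Pi.single c 1 + Pi.single d 1 : α → ℕ)) (a := a)
    (by simp [hb, hc, hd])
  simpa only [Pi.add_apply, pow_add, Finset.prod_mul_distrib, prod_pow_single,
    pow_one] using h_moment

/-- Wick's formula for four coordinates of a standard Gaussian vector. -/
theorem integral_mul_four_gVecR (a b c d : α) :
    ∫ x, x a * x b * x c * x d ∂gVecR α =
      kron a b * kron c d + kron a c * kron b d + kron a d * kron b c := by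
  have pair : ∀ {a b : α}, a ≠ b → ∀ {f : (α → ℝ) → ℝ}, (∀ x, f x = x a ^ 2 * x b ^ 2) →
      ∫ x, f x ∂gVecR α = 1 := fun h f hf => by
    simp only [hf]; exact integral_sq_mul_sq_gVecR h
  by_cases hab : a = b
  · subst hab
    by_cases hcd : c = d
    · subst hcd
      by_cases hac : a = c
      · subst hac
        rw [integral_congr_ae (g := fun x => x a ^ 4) (.of_forall fun x => by ring),
          integral_pow_apply_gVecR,
          integral_sq_gaussianReal_and_integral_pow_four_gaussianReal.2]
        simp [kron]; norm_num
      · rw [pair hac fun x => by ring]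
        simp [kron, hac]
    · have hz : kron a a * kron c d + kron a c * kron a d + kron a d * kron a c = 0 := by
        by_cases hac : a = c
        · subst hac; simp [kron, hcd]
        · simp [kron, hcd, hac]
      rw [hz]
      by_cases hac : a = c
      · subst hac
        rw [← integral_mul_four_gVecR_eq_zero (a := d) (b := a) (c := a) (d := a)
          (Ne.symm hcd) (Ne.symm hcd) (Ne.symm hcd)]
        exact integral_congr_ae (.of_forall fun x => by ring)
      · rw [← integral_mul_four_gVecR_eq_zero (a := c) (b := a) (c := a) (d := d)
          (Ne.symm hac) (Ne.symm hac) hcd]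
        exact integral_congr_ae (.of_forall fun x => by ring)
  · by_cases hac : a = c
    · subst hac
      by_cases hbd : b = d
      · subst hbd
        rw [pair hab fun x => by ring]
        simp [kron, hab, Ne.symm hab]
      · rw [show kron a b * kron a d + kron a a * kron b d + kron a d * kron b a = 0 by
          simp [kron, hab, hbd, Ne.symm hab]]
        rw [← integral_mul_four_gVecR_eq_zero (a := b) (b := a) (c := a) (d := d)
          (Ne.symm hab) (Ne.symm hab) hbd]
        exact integral_congr_ae (.of_forall fun x => by ring)
    · by_cases had : a = d
      · subst had
        by_cases hbc : b = c
        · subst hbc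
          rw [pair hab fun x => by ring]
          simp [kron, hab]
        · rw [show kron a b * kron c a + kron a c * kron b a + kron a a * kron b c = 0 by
            simp [kron, hab, hac, hbc]]
          rw [← integral_mul_four_gVecR_eq_zero (a := b) (b := a) (c := a) (d := c)
            (Ne.symm hab) (Ne.symm hab) hbc]
          exact integral_congr_ae (.of_forall fun x => by ring)
      · rw [integral_mul_four_gVecR_eq_zero hab hac had]
        simp [kron, hab, hac, had]

theorem integrable_and_integral_mul_noisy (s t : ℝ) (hst : s ^ 2 + t ^ 2 = 1) (a b c d : α) :
    Integrable (fun q : (α → ℝ) × (α → ℝ) =>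
      q.1 a * q.1 b * ((s * q.1 c + t * q.2 c) * (s * q.1 d + t * q.2 d)))
      ((gVecR α).prod (gVecR α)) ∧
    ∫ q : (α → ℝ) × (α → ℝ),
      q.1 a * q.1 b * ((s * q.1 c + t * q.2 c) * (s * q.1 d + t * q.2 d))
      ∂((gVecR α).prod (gVecR α)) =
      s ^ 2 * (kron a c * kron b d + kron a d * kron b c) + kron a b * kron c d := by
  simp only [mul_noisy_eq]
  have i1 := ((integrable_mul_four_gVecR a b c d).comp_fst (gVecR α)).const_mul (s ^ 2)
  have i2 := ((integrable_mul_three_gVecR a b c).mul_prod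
    (integrable_apply_gVecR d)).const_mul (s * t)
  have i3 := ((integrable_mul_three_gVecR a b d).mul_prod
    (integrable_apply_gVecR c)).const_mul (s * t)
  have i4 := ((integrable_mul_two_gVecR a b).mul_prod
    (integrable_mul_two_gVecR c d)).const_mul (t ^ 2)
  refine ⟨((i1.add i2).add i3).add i4, ?_⟩
  rw [integral_add ?_ i4, integral_add ?_ i3, integral_add i1 i2]
  rotate_left
  · exact i1.add i2
  · exact (i1.add i2).add i3
  simp only [integral_const_mul]
  rw [integral_prod_mul (fun x : α → ℝ => x a * x b * x c) (fun u : α → ℝ => u d),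
    integral_prod_mul (fun x : α → ℝ => x a * x b * x d) (fun u : α → ℝ => u c),
    integral_prod_mul (fun x : α → ℝ => x a * x b) (fun u : α → ℝ => u c * u d),
    integral_fun_fst (fun x : α → ℝ => x a * x b * x c * x d)]
  simp only [integral_mul_two_gVecR, integral_mul_four_gVecR, integral_apply_gVecR]
  simp only [probReal_univ, one_smul]
  linear_combination kron a b * kron c d * hst

end GaussianVector

theorem sq_rperm_mul_sq_rperm_noisyR {n : ℕ} (ε : ℝ) (X U : Fin n → Fin n → ℝ) :
    rperm X ^ 2 * rperm (noisyR ε X U) ^ 2 =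
      ∑ σ₁ : Equiv.Perm (Fin n), ∑ σ₂ : Equiv.Perm (Fin n), ∑ τ₁ : Equiv.Perm (Fin n),
        ∑ τ₂ : Equiv.Perm (Fin n), ∏ i, (X i (σ₁ i) * X i (σ₂ i) *
          ((√(1 - ε) * X i (τ₁ i) + √ε * U i (τ₁ i)) *
            (√(1 - ε) * X i (τ₂ i) + √ε * U i (τ₂ i)))) := by
  simp only [Finset.prod_mul_distrib, ← Finset.mul_sum, ← Finset.sum_mul, sq]
  rfl

/-- E[perm(X)²·perm(Y)²] = (n!)²·Σ_{m=0}^{n}(m+1)·(1−ε)^m, where Y is an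
ε-noise of the n×n real Gaussian matrix X. -/
theorem mixed_moment_perm_noise_real (n : ℕ) (ε : ℝ) (hε : ε ∈ Set.Ioo (0 : ℝ) 1) :
    (∫ p, (rperm p.1) ^ 2 * (rperm (noisyR ε p.1 p.2)) ^ 2
        ∂((gMatR n).prod (gMatR n))) =
      (Nat.factorial n : ℝ) ^ 2 *
        ∑ m ∈ Finset.range (n + 1), ((m : ℝ) + 1) * (1 - ε) ^ m := by
  have hs : √(1 - ε) ^ 2 = 1 - ε := Real.sq_sqrt (by linarith [hε.2])
  have hst : √(1 - ε) ^ 2 + √ε ^ 2 = 1 := by rw [hs, Real.sq_sqrt hε.1.le]; ring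
  have hsum := sum_prod_kron_perm (Fin n) (1 - ε)
  rw [Fintype.card_fin] at hsum
  rw [← hsum]
  change ∫ p, (rperm p.1) ^ 2 * (rperm (noisyR ε p.1 p.2)) ^ 2
    ∂((Measure.pi fun _ => gVecR (Fin n)).prod (Measure.pi fun _ => gVecR (Fin n))) = _
  rw [← (measurePreserving_arrowProdEquivProdArrow _ _ _ (fun _ : Fin n => gVecR (Fin n))
    fun _ => gVecR (Fin n)).integral_comp']
  simp only [sq_rperm_mul_sq_rperm_noisyR]
  have row := fun a b c d : Fin n =>
    integrable_and_integral_mul_noisy (√(1 - ε)) (√ε) hst a b c d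
  have hint : ∀ σ₁ σ₂ τ₁ τ₂ : Equiv.Perm (Fin n), Integrable
      (fun q : Fin n → (Fin n → ℝ) × (Fin n → ℝ) => ∏ i, ((q i).1 (σ₁ i) * (q i).1 (σ₂ i) *
        ((√(1 - ε) * (q i).1 (τ₁ i) + √ε * (q i).2 (τ₁ i)) *
          (√(1 - ε) * (q i).1 (τ₂ i) + √ε * (q i).2 (τ₂ i)))))
      (Measure.pi fun _ => (gVecR (Fin n)).prod (gVecR (Fin n))) := fun σ₁ σ₂ τ₁ τ₂ =>
    Integrable.fintype_prod fun i => (row (σ₁ i) (σ₂ i) (τ₁ i) (τ₂ i)).1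
  change ∫ q : Fin n → (Fin n → ℝ) × (Fin n → ℝ),
      ∑ σ₁ : Equiv.Perm (Fin n), ∑ σ₂ : Equiv.Perm (Fin n), ∑ τ₁ : Equiv.Perm (Fin n),
        ∑ τ₂ : Equiv.Perm (Fin n), ∏ i, ((q i).1 (σ₁ i) * (q i).1 (σ₂ i) *
        ((√(1 - ε) * (q i).1 (τ₁ i) + √ε * (q i).2 (τ₁ i)) *
          (√(1 - ε) * (q i).1 (τ₂ i) + √ε * (q i).2 (τ₂ i)))) ∂_ = _
  have h3 := fun σ₁ σ₂ τ₁ => integrable_finsetSum Finset.univ fun τ₂ _ => hint σ₁ σ₂ τ₁ τ₂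
  have h2 := fun σ₁ σ₂ => integrable_finsetSum Finset.univ fun τ₁ _ => h3 σ₁ σ₂ τ₁
  have h1 := fun σ₁ => integrable_finsetSum Finset.univ fun σ₂ _ => h2 σ₁ σ₂
  rw [integral_finsetSum _ fun σ₁ _ => h1 σ₁]
  refine Finset.sum_congr rfl fun σ₁ _ => ?_
  rw [integral_finsetSum _ fun σ₂ _ => h2 σ₁ σ₂]
  refine Finset.sum_congr rfl fun σ₂ _ => ?_
  rw [integral_finsetSum _ fun τ₁ _ => h3 σ₁ σ₂ τ₁]
  refine Finset.sum_congr rfl fun τ₁ _ => ?_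
  rw [integral_finsetSum _ fun τ₂ _ => hint σ₁ σ₂ τ₁ τ₂]
  refine Finset.sum_congr rfl fun τ₂ _ => ?_
  rw [integral_fintype_prod_eq_prod (fun i (q : (Fin n → ℝ) × (Fin n → ℝ)) =>
    q.1 (σ₁ i) * q.1 (σ₂ i) * ((√(1 - ε) * q.1 (τ₁ i) + √ε * q.2 (τ₁ i)) *
      (√(1 - ε) * q.1 (τ₂ i) + √ε * q.2 (τ₂ i))))]
  exact Finset.prod_congr rfl fun i _ => by rw [(row _ _ _ _).2, hs]
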